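/- arXiv:2505.08966 — 12 statements merged into one kernel-verified Lean document; each statement's English description precedes it below -/
import Mathlib

section
/- Let A, B, C ∈ (0, π/2) with A + B + C = π, and suppose min{ sin(A)sin(B)cos(C)/sin²(C), sin(B)sin(C)cos(A)/sin²(A), sin(C)sin(A)cos(B)/sin²(B) } ≥ δ for some δ > 0. Then sin(A)·sin(B)·sin(C)/(sin(A) + sin(B) + sin(C)) ≥ (1/3)·sin³(arctan(√δ)). -/
open Real

/-- In an acute triangle, two cyclic lower bounds by `δ` force `√δ ≤ sin A`. -/
lemma sqrt_le_sin_of_acute {A B C δ : ℝ} (hA : A ∈ Set.Ioo 0 (π / 2))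
    (hB : B ∈ Set.Ioo 0 (π / 2)) (hC : C ∈ Set.Ioo 0 (π / 2)) (hsum : A + B + C = π)
    (hδ : 0 < δ) (h₁ : δ ≤ sin A * sin B * cos C / sin C ^ 2)
    (h₂ : δ ≤ sin C * sin A * cos B / sin B ^ 2) : √δ ≤ sin A := by
  obtain ⟨hA0, hA1⟩ := hA
  obtain ⟨hB0, hB1⟩ := hB
  obtain ⟨hC0, hC1⟩ := hC
  have sA : 0 < sin A := sin_pos_of_pos_of_lt_pi hA0 (by linarith)
  have sB : 0 < sin B := sin_pos_of_pos_of_lt_pi hB0 (by linarith)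
  have sC : 0 < sin C := sin_pos_of_pos_of_lt_pi hC0 (by linarith)
  have cC : 0 < cos C := cos_pos_of_mem_Ioo ⟨by linarith, hC1⟩
  rw [le_div_iff₀ (by positivity)] at h₁ h₂
  have hadd : sin A = sin B * cos C + cos B * sin C := by
    rw [← sin_add, ← sin_pi_sub]
    congr 1
    linarith
  have hcos : cos C ≤ sin B := by
    rw [← sin_pi_div_two_sub]
    exact sin_le_sin_of_le_of_le_pi_div_two (by linarith) hB1.le (by linarith)
  have hsq : 1 ≤ sin B ^ 2 + sin C ^ 2 := by
    nlinarith [sin_sq_add_cos_sq C]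
  have hA2 : sin A ^ 2 = sin A * sin B * cos C + sin C * sin A * cos B := by
    linear_combination sin A * hadd
  apply sqrt_le_iff.mpr ⟨sA.le, ?_⟩
  nlinarith [mul_le_mul_of_nonneg_left hsq hδ.le]

theorem shape_constant_lower_bound_of_dec_constant
    (A B C δ : ℝ) (hA : A ∈ Set.Ioo 0 (π / 2)) (hB : B ∈ Set.Ioo 0 (π / 2))
    (hC : C ∈ Set.Ioo 0 (π / 2)) (hsum : A + B + C = π) (hδ : 0 < δ)
    (h : min (min (Real.sin A * Real.sin B * Real.cos C / (Real.sin C) ^ 2)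
                  (Real.sin B * Real.sin C * Real.cos A / (Real.sin A) ^ 2))
             (Real.sin C * Real.sin A * Real.cos B / (Real.sin B) ^ 2) ≥ δ) :
    Real.sin A * Real.sin B * Real.sin C / (Real.sin A + Real.sin B + Real.sin C)
      ≥ (1 / 3) * (Real.sin (Real.arctan (Real.sqrt δ))) ^ 3 := by
  obtain ⟨h₁₂, h₃⟩ := le_min_iff.mp h
  obtain ⟨h₁, h₂⟩ := le_min_iff.mp h₁₂
  have hsδ : 0 < √δ := sqrt_pos.mpr hδ
  have lA := sqrt_le_sin_of_acute hA hB hC hsum hδ h₁ h₃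
  have lB := sqrt_le_sin_of_acute hB hC hA (by linarith) hδ h₂ h₁
  have lC := sqrt_le_sin_of_acute hC hA hB (by linarith) hδ h₃ h₂
  have ht0 : 0 ≤ sin (arctan √δ) := by rw [sin_arctan]; positivity
  have ht : sin (arctan √δ) ≤ √δ := by
    rw [sin_arctan]
    exact div_le_self hsδ.le (one_le_sqrt.mpr (by nlinarith))
  have hpow : sin (arctan √δ) ^ 3 ≤ √δ * √δ * √δ := by
    calc sin (arctan √δ) ^ 3 ≤ √δ ^ 3 := by gcongr
      _ = √δ * √δ * √δ := by ring
  have hprod : √δ * √δ * √δ ≤ sin A * sin B * sin C := by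
    have := hsδ.le.trans lA
    have := hsδ.le.trans lB
    gcongr
  have ht3 : 0 ≤ sin (arctan √δ) ^ 3 := by positivity
  rw [ge_iff_le, le_div_iff₀ (by linarith)]
  have hle : sin A + sin B + sin C ≤ 3 := by
    linarith [sin_le_one A, sin_le_one B, sin_le_one C]
  nlinarith [mul_le_mul_of_nonneg_left hle ht3]
end

section
/- Let δ ∈ (0, π/4) and let A, B, C ∈ (0, π/2 − δ] with A + B + C = π. Then sin(A)·sin(B)·cos(C)/sin²(C) ≥ sin²(2δ)·sin(δ), and the analogous bounds hold for the other two cyclic labelings of the angles; in particular the DEC constant δ_T = min over labelings of sin(A)sin(B)cos(C)/sin²(C) is bounded below by sin²(2δ)·sin(δ). -/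
open Real

/-- In a uniformly acute triangle with constant `δ`, the sine of every angle is at least
`sin (2 * δ)`. -/
theorem sin_two_mul_le_sin_of_uniformly_acute {δ A B C : ℝ} (hδ : 0 ≤ δ)
    (hA : A ≤ π / 2 - δ) (hB : B ≤ π / 2 - δ) (hC : C ≤ π / 2 - δ) (hsum : A + B + C = π) :
    sin (2 * δ) ≤ sin A :=
  sin_le_sin_of_le_of_le_pi_div_two (by linarith [pi_pos]) (by linarith) (by linarith)

/-- The lower bound on the DEC constant of a uniformly acute triangle, for one labeling. -/
theorem sin_mul_sin_mul_cos_div_sin_sq_ge_of_uniformly_acute {δ A B C : ℝ} (hδ : 0 ≤ δ)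
    (hA : A ≤ π / 2 - δ) (hB : B ≤ π / 2 - δ) (hC₀ : 0 < C) (hC : C ≤ π / 2 - δ)
    (hsum : A + B + C = π) :
    sin A * sin B * cos C / sin C ^ 2 ≥ sin (2 * δ) ^ 2 * sin δ := by
  have hδ' : 2 * δ ≤ π := by linarith
  have h2δ : 0 ≤ sin (2 * δ) := sin_nonneg_of_nonneg_of_le_pi (by linarith) hδ'
  have hsδ : 0 ≤ sin δ := sin_nonneg_of_nonneg_of_le_pi hδ (by linarith)
  have hsA : sin (2 * δ) ≤ sin A := sin_two_mul_le_sin_of_uniformly_acute hδ hA hB hC hsum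
  have hsB : sin (2 * δ) ≤ sin B :=
    sin_two_mul_le_sin_of_uniformly_acute hδ hB hA hC (by linarith)
  have hcC : sin δ ≤ cos C := by
    rw [← cos_pi_div_two_sub]
    exact cos_le_cos_of_nonneg_of_le_pi hC₀.le (by linarith [pi_pos]) hC
  have hsC : 0 < sin C := sin_pos_of_pos_of_lt_pi hC₀ (by linarith [pi_pos])
  calc sin (2 * δ) ^ 2 * sin δ = sin (2 * δ) * sin (2 * δ) * sin δ := by ring
    _ ≤ sin A * sin B * cos C := by
      have hA₀ := h2δ.trans hsA
      have hB₀ := h2δ.trans hsB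
      gcongr
    _ ≤ sin A * sin B * cos C / sin C ^ 2 :=
      le_div_self (mul_nonneg (mul_nonneg (h2δ.trans hsA) (h2δ.trans hsB)) (hsδ.trans hcC))
        (pow_pos hsC 2) (sin_sq_le_one C)

theorem dec_constant_lower_bound_of_uniformly_acute
    (δ A B C : ℝ) (hδ : δ ∈ Set.Ioo 0 (π / 4))
    (hA : A ∈ Set.Ioc 0 (π / 2 - δ)) (hB : B ∈ Set.Ioc 0 (π / 2 - δ))
    (hC : C ∈ Set.Ioc 0 (π / 2 - δ)) (hsum : A + B + C = π) :
    Real.sin A * Real.sin B * Real.cos C / (Real.sin C) ^ 2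
        ≥ (Real.sin (2 * δ)) ^ 2 * Real.sin δ ∧
    Real.sin B * Real.sin C * Real.cos A / (Real.sin A) ^ 2
        ≥ (Real.sin (2 * δ)) ^ 2 * Real.sin δ ∧
    Real.sin C * Real.sin A * Real.cos B / (Real.sin B) ^ 2
        ≥ (Real.sin (2 * δ)) ^ 2 * Real.sin δ ∧
    min (min (Real.sin A * Real.sin B * Real.cos C / (Real.sin C) ^ 2)
             (Real.sin B * Real.sin C * Real.cos A / (Real.sin A) ^ 2))
        (Real.sin C * Real.sin A * Real.cos B / (Real.sin B) ^ 2)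
        ≥ (Real.sin (2 * δ)) ^ 2 * Real.sin δ := by
  have hC_bound := sin_mul_sin_mul_cos_div_sin_sq_ge_of_uniformly_acute hδ.1.le
    hA.2 hB.2 hC.1 hC.2 hsum
  have hA_bound := sin_mul_sin_mul_cos_div_sin_sq_ge_of_uniformly_acute hδ.1.le
    hB.2 hC.2 hA.1 hA.2 (by linarith)
  have hB_bound := sin_mul_sin_mul_cos_div_sin_sq_ge_of_uniformly_acute hδ.1.le
    hC.2 hA.2 hB.1 hB.2 (by linarith)
  exact ⟨hC_bound, hA_bound, hB_bound, le_min (le_min hC_bound hA_bound) hB_bound⟩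
end

section
/- Let A, B, C ∈ (0, π) with A + B + C = π, A ≤ C and B ≤ C (so C is the largest angle). If sin(A)·sin(B)·cos(C)/sin²(C) ≥ δ for some δ > 0, then cos(C) ≥ δ, and hence C ≤ π/2 − arcsin(δ). -/
open Real

/-- In a triangle, the larger of two angles has the larger sine. -/
theorem sin_le_sin_of_le_of_add_le_pi {x y : ℝ} (hx : 0 ≤ x) (hxy : x ≤ y) (hadd : x + y ≤ π) :
    Real.sin x ≤ Real.sin y := by
  have hs : 0 ≤ Real.sin ((y - x) / 2) :=
    Real.sin_nonneg_of_nonneg_of_le_pi (by linarith) (by linarith)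
  have hc : 0 ≤ Real.cos ((y + x) / 2) :=
    Real.cos_nonneg_of_neg_pi_div_two_le_of_le (by linarith [Real.pi_pos]) (by linarith)
  have hdiff := Real.sin_sub_sin y x
  have hprod := mul_nonneg hs hc
  linarith

theorem largest_angle_acute_of_dec_constant
    (A B C δ : ℝ) (hA : A ∈ Set.Ioo 0 π) (hB : B ∈ Set.Ioo 0 π) (hC : C ∈ Set.Ioo 0 π)
    (hsum : A + B + C = π) (hAC : A ≤ C) (hBC : B ≤ C) (hδ : 0 < δ)
    (h : Real.sin A * Real.sin B * Real.cos C / (Real.sin C) ^ 2 ≥ δ) :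
    Real.cos C ≥ δ ∧ C ≤ π / 2 - Real.arcsin δ := by
  have hsA := Real.sin_pos_of_mem_Ioo hA
  have hsB := Real.sin_pos_of_mem_Ioo hB
  have hsC := Real.sin_pos_of_mem_Ioo hC
  have hAC' : Real.sin A ≤ Real.sin C :=
    sin_le_sin_of_le_of_add_le_pi hA.1.le hAC (by linarith [hB.1])
  have hBC' : Real.sin B ≤ Real.sin C :=
    sin_le_sin_of_le_of_add_le_pi hB.1.le hBC (by linarith [hA.1])
  have hδC : δ * Real.sin C ^ 2 ≤ Real.sin A * Real.sin B * Real.cos C :=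
    (le_div_iff₀ (by positivity)).1 h
  have hcos : 0 < Real.cos C :=
    pos_of_mul_pos_right ((by positivity : 0 < δ * Real.sin C ^ 2).trans_le hδC) (by positivity)
  have hprod : Real.sin A * Real.sin B ≤ Real.sin C ^ 2 := by
    rw [sq]
    gcongr
  have hle : δ ≤ Real.cos C := by
    refine le_of_mul_le_mul_right (hδC.trans ?_) (by positivity : 0 < Real.sin C ^ 2)
    rw [mul_comm (Real.cos C)]
    gcongr
  refine ⟨hle, ?_⟩
  have harc := Real.arcsin_le_arcsin hle
  rw [Real.arcsin_eq_pi_div_two_sub_arccos (Real.cos C),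
    Real.arccos_cos hC.1.le hC.2.le] at harc
  linarith
end

section
/- Let δ₀, δ_π > 0 and let C₁, C₂ ∈ [δ₀, π) with C₁ + C₂ ≤ π − δ_π. Then cos(C₁)/(2·sin(C₁)) + cos(C₂)/(2·sin(C₂)) = sin(C₁ + C₂)/(2·sin(C₁)·sin(C₂)) ≥ (1/2)·min{ sin(δ_π), sin(2δ₀) }. -/
open Real

theorem dec_hodge_star_internal_edge_lower_bound
    (δ₀ δπ C₁ C₂ : ℝ) (hδ₀ : 0 < δ₀) (hδπ : 0 < δπ)
    (hC₁ : C₁ ∈ Set.Ico δ₀ π) (hC₂ : C₂ ∈ Set.Ico δ₀ π)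
    (hDel : C₁ + C₂ ≤ π - δπ) :
    Real.cos C₁ / (2 * Real.sin C₁) + Real.cos C₂ / (2 * Real.sin C₂)
      = Real.sin (C₁ + C₂) / (2 * Real.sin C₁ * Real.sin C₂) ∧
    Real.sin (C₁ + C₂) / (2 * Real.sin C₁ * Real.sin C₂)
      ≥ (1 / 2) * min (Real.sin δπ) (Real.sin (2 * δ₀)) := by
  have hs₁ : 0 < Real.sin C₁ := Real.sin_pos_of_pos_of_lt_pi (hδ₀.trans_le hC₁.1) hC₁.2
  have hs₂ : 0 < Real.sin C₂ := Real.sin_pos_of_pos_of_lt_pi (hδ₀.trans_le hC₂.1) hC₂.2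
  have hlow : 2 * δ₀ ≤ C₁ + C₂ := by linarith [hC₁.1, hC₂.1]
  have hmin : min (Real.sin δπ) (Real.sin (2 * δ₀)) ≤ Real.sin (C₁ + C₂) := by
    have h := strictConcaveOn_sin_Icc.concaveOn.min_le_of_mem_Icc
      (x := 2 * δ₀) (y := π - δπ) (z := C₁ + C₂)
      ⟨by linarith, by linarith⟩ ⟨by linarith, by linarith⟩ ⟨hlow, hDel⟩
    rwa [Real.sin_pi_sub, min_comm] at h
  have hnonneg : 0 ≤ Real.sin (C₁ + C₂) :=
    Real.sin_nonneg_of_nonneg_of_le_pi (by linarith) (by linarith)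
  have hprod : Real.sin C₁ * Real.sin C₂ ≤ 1 :=
    mul_le_one₀ (Real.sin_le_one C₁) hs₂.le (Real.sin_le_one C₂)
  constructor
  · rw [Real.sin_add]
    field_simp
    ring
  · rw [ge_iff_le, le_div_iff₀ (by positivity)]
    calc (1 / 2) * min (Real.sin δπ) (Real.sin (2 * δ₀)) * (2 * Real.sin C₁ * Real.sin C₂)
        = min (Real.sin δπ) (Real.sin (2 * δ₀)) * (Real.sin C₁ * Real.sin C₂) := by ring
      _ ≤ Real.sin (C₁ + C₂) * (Real.sin C₁ * Real.sin C₂) := by gcongr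
      _ ≤ Real.sin (C₁ + C₂) := mul_le_of_le_one_right hnonneg hprod
end

section
/- Let δ₀, δ_π > 0 and c > 0. For i = 1, 2 let Aᵢ, Bᵢ, Cᵢ ∈ [δ₀, π) with Aᵢ + Bᵢ + Cᵢ = π, and set aᵢ = c·sin(Aᵢ)/sin(Cᵢ) and bᵢ = c·sin(Bᵢ)/sin(Cᵢ). Assume C₁ + C₂ ≤ π − δ_π. Define N_D := sin(C₁+C₂)/(2·sin(C₁)·sin(C₂)) and N_F := c²·( 1/(12·a₁·b₁·sin(C₁)) + 1/(12·a₂·b₂·sin(C₂)) ) + sin(C₁+C₂)/(4·sin(C₁)·sin(C₂)). Then N_D ≤ 2·N_F and N_D ≥ c₁·N_F, where c₁ = 3·δ'·sin²(δ₀)/(1 + 3·δ'·sin²(δ₀)) and δ' = (1/2)·min{ sin(δ_π), sin(2δ₀) }. -/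
open Real

/-- On `[x, π - y]` the sine is at least the smaller of its values at the endpoints. -/
theorem min_sin_le_sin {x y z : ℝ} (hx : 0 ≤ x) (hy : 0 ≤ y) (hxz : x ≤ z) (hzy : z ≤ π - y) :
    min (Real.sin y) (Real.sin x) ≤ Real.sin z := by
  rcases le_total z (π / 2) with h | h
  · exact (min_le_right _ _).trans
      (Real.sin_le_sin_of_le_of_le_pi_div_two (by linarith [Real.pi_pos]) h hxz)
  · refine (min_le_left _ _).trans ?_
    rw [← Real.sin_pi_sub z]
    exact Real.sin_le_sin_of_le_of_le_pi_div_two (by linarith [Real.pi_pos]) (by linarith)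
      (by linarith)

/-- The diagonal contribution of a triangle with all angles at least `δ` to the squared `L²` norm
of the Whitney form of an edge of length `c` opposite the angle `C`. -/
theorem whitney_term_bounds {δ c A B C : ℝ} (hδ : 0 < δ) (hc : 0 < c)
    (hA : δ ≤ A) (hB : δ ≤ B) (hC : δ ≤ C) (hsum : A + B + C = π) :
    0 ≤ c ^ 2 * (1 / (12 * (c * Real.sin A / Real.sin C) * (c * Real.sin B / Real.sin C)
      * Real.sin C)) ∧
    c ^ 2 * (1 / (12 * (c * Real.sin A / Real.sin C) * (c * Real.sin B / Real.sin C)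
      * Real.sin C)) ≤ 1 / (12 * Real.sin δ ^ 2) := by
  have hsA : Real.sin δ ≤ Real.sin A := by
    simpa using min_sin_le_sin hδ.le hδ.le hA (by linarith)
  have hsB : Real.sin δ ≤ Real.sin B := by
    simpa using min_sin_le_sin hδ.le hδ.le hB (by linarith)
  have hs : 0 < Real.sin δ := Real.sin_pos_of_pos_of_lt_pi hδ (by linarith)
  have hsC : 0 < Real.sin C := Real.sin_pos_of_pos_of_lt_pi (by linarith) (by linarith)
  have hA0 : 0 < Real.sin A := hs.trans_le hsA
  have hB0 : 0 < Real.sin B := hs.trans_le hsB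
  have key : c ^ 2 * (1 / (12 * (c * Real.sin A / Real.sin C) * (c * Real.sin B / Real.sin C)
      * Real.sin C)) = Real.sin C / (12 * (Real.sin A * Real.sin B)) := by
    field_simp
  rw [key, sq]
  exact ⟨by positivity, by gcongr; exact Real.sin_le_one C⟩

theorem dec_feec_basis_one_form_internal_edge
    (δ₀ δπ c : ℝ) (hδ₀ : 0 < δ₀) (hδπ : 0 < δπ) (hc : 0 < c)
    (A₁ B₁ C₁ A₂ B₂ C₂ : ℝ)
    (hA₁ : A₁ ∈ Set.Ico δ₀ π) (hB₁ : B₁ ∈ Set.Ico δ₀ π) (hC₁ : C₁ ∈ Set.Ico δ₀ π)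
    (hA₂ : A₂ ∈ Set.Ico δ₀ π) (hB₂ : B₂ ∈ Set.Ico δ₀ π) (hC₂ : C₂ ∈ Set.Ico δ₀ π)
    (hsum₁ : A₁ + B₁ + C₁ = π) (hsum₂ : A₂ + B₂ + C₂ = π)
    (a₁ b₁ a₂ b₂ : ℝ)
    (ha₁ : a₁ = c * Real.sin A₁ / Real.sin C₁) (hb₁ : b₁ = c * Real.sin B₁ / Real.sin C₁)
    (ha₂ : a₂ = c * Real.sin A₂ / Real.sin C₂) (hb₂ : b₂ = c * Real.sin B₂ / Real.sin C₂)
    (hDel : C₁ + C₂ ≤ π - δπ)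
    (N_D N_F δ' c₁ : ℝ)
    (hND : N_D = Real.sin (C₁ + C₂) / (2 * Real.sin C₁ * Real.sin C₂))
    (hNF : N_F = c ^ 2 * (1 / (12 * a₁ * b₁ * Real.sin C₁) + 1 / (12 * a₂ * b₂ * Real.sin C₂))
        + Real.sin (C₁ + C₂) / (4 * Real.sin C₁ * Real.sin C₂))
    (hδ' : δ' = (1 / 2) * min (Real.sin δπ) (Real.sin (2 * δ₀)))
    (hc₁ : c₁ = 3 * δ' * (Real.sin δ₀) ^ 2 / (1 + 3 * δ' * (Real.sin δ₀) ^ 2)) :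
    N_D ≤ 2 * N_F ∧ N_D ≥ c₁ * N_F := by
  obtain ⟨hP₁, hP₁'⟩ := whitney_term_bounds hδ₀ hc hA₁.1 hB₁.1 hC₁.1 hsum₁
  obtain ⟨hP₂, hP₂'⟩ := whitney_term_bounds hδ₀ hc hA₂.1 hB₂.1 hC₂.1 hsum₂
  rw [← ha₁, ← hb₁] at hP₁ hP₁'
  rw [← ha₂, ← hb₂] at hP₂ hP₂'
  obtain ⟨hA₁, -⟩ := hA₁
  obtain ⟨hB₁, -⟩ := hB₁
  obtain ⟨hC₁, hC₁π⟩ := hC₁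
  obtain ⟨hC₂, hC₂π⟩ := hC₂
  have hs : 0 < Real.sin δ₀ := Real.sin_pos_of_pos_of_lt_pi hδ₀ (by linarith)
  have hs₁ : 0 < Real.sin C₁ := Real.sin_pos_of_pos_of_lt_pi (by linarith) hC₁π
  have hs₂ : 0 < Real.sin C₂ := Real.sin_pos_of_pos_of_lt_pi (by linarith) hC₂π
  have hδ'0 : 0 < δ' := by
    rw [hδ']
    exact mul_pos (by norm_num) (lt_min
      (Real.sin_pos_of_pos_of_lt_pi hδπ (by linarith))
      (Real.sin_pos_of_pos_of_lt_pi (by linarith) (by linarith)))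
  have hS : 2 * δ' ≤ Real.sin (C₁ + C₂) := by
    have := min_sin_le_sin (x := 2 * δ₀) (by linarith) hδπ.le (by linarith) hDel
    linarith
  have hD : δ' ≤ N_D := by
    rw [hND, le_div_iff₀ (by positivity)]
    have h := mul_le_one₀ (Real.sin_le_one C₁) hs₂.le (Real.sin_le_one C₂)
    nlinarith
  have hF : N_F = c ^ 2 * (1 / (12 * a₁ * b₁ * Real.sin C₁))
      + c ^ 2 * (1 / (12 * a₂ * b₂ * Real.sin C₂)) + N_D / 2 := by
    rw [hNF, hND]
    ring
  have hFle : N_F ≤ 1 / (6 * Real.sin δ₀ ^ 2) + N_D / 2 := by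
    have : 1 / (6 * Real.sin δ₀ ^ 2)
        = 1 / (12 * Real.sin δ₀ ^ 2) + 1 / (12 * Real.sin δ₀ ^ 2) := by
      field_simp
      norm_num
    linarith
  refine ⟨by linarith, ?_⟩
  have ht : 0 < 3 * δ' * Real.sin δ₀ ^ 2 := by positivity
  rw [ge_iff_le, hc₁, div_mul_eq_mul_div, div_le_iff₀ (by positivity)]
  calc 3 * δ' * Real.sin δ₀ ^ 2 * N_F
      ≤ 3 * δ' * Real.sin δ₀ ^ 2 * (1 / (6 * Real.sin δ₀ ^ 2) + N_D / 2) := by gcongr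
    _ = δ' / 2 + 3 * δ' * Real.sin δ₀ ^ 2 * N_D / 2 := by
      field_simp
      ring
    _ ≤ N_D * (1 + 3 * δ' * Real.sin δ₀ ^ 2) := by nlinarith [mul_pos ht (hδ'0.trans_le hD)]
end

section
/- Let δ₀ > 0 and let A, B, C ∈ [δ₀, π) with A + B + C = π. Then |sin(B)·cos(B) + sin(C)·cos(C)| / (4·sin(A)·sin(B)·sin(C)) ≤ 1/(2·sin³(δ₀)). -/
open Real

/-- The sine of an angle in `[δ, π - δ]` is at least `sin δ`. -/
theorem sin_le_sin_of_le_of_le_pi_sub {δ x : ℝ} (hδ : 0 ≤ δ) (h₁ : δ ≤ x) (h₂ : x ≤ π - δ) :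
    Real.sin δ ≤ Real.sin x := by
  rw [← sub_nonneg, Real.sin_sub_sin]
  have hs : 0 ≤ Real.sin ((x - δ) / 2) :=
    Real.sin_nonneg_of_nonneg_of_le_pi (by linarith) (by linarith)
  have hc : 0 ≤ Real.cos ((x + δ) / 2) :=
    Real.cos_nonneg_of_neg_pi_div_two_le_of_le (by linarith [Real.pi_pos]) (by linarith)
  positivity

theorem abs_sin_mul_cos_le_one (x : ℝ) : |Real.sin x * Real.cos x| ≤ 1 := by
  rw [abs_mul]
  exact mul_le_one₀ (Real.abs_sin_le_one x) (abs_nonneg _) (Real.abs_cos_le_one x)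

theorem dual_area_ratio_bounded_of_shape_regular
    (δ₀ A B C : ℝ) (hδ₀ : 0 < δ₀)
    (hA : A ∈ Set.Ico δ₀ π) (hB : B ∈ Set.Ico δ₀ π) (hC : C ∈ Set.Ico δ₀ π)
    (hsum : A + B + C = π) :
    |Real.sin B * Real.cos B + Real.sin C * Real.cos C|
        / (4 * Real.sin A * Real.sin B * Real.sin C)
      ≤ 1 / (2 * (Real.sin δ₀) ^ 3) := by
  obtain ⟨hA, hAπ⟩ := hA
  obtain ⟨hB, -⟩ := hB
  obtain ⟨hC, -⟩ := hC
  have hs : 0 < Real.sin δ₀ := Real.sin_pos_of_pos_of_lt_pi hδ₀ (by linarith)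
  have hsA := sin_le_sin_of_le_of_le_pi_sub hδ₀.le hA (by linarith)
  have hsB := sin_le_sin_of_le_of_le_pi_sub hδ₀.le hB (by linarith)
  have hsC := sin_le_sin_of_le_of_le_pi_sub hδ₀.le hC (by linarith)
  have hA₀ : 0 < Real.sin A := hs.trans_le hsA
  have hB₀ : 0 < Real.sin B := hs.trans_le hsB
  have hnum : |Real.sin B * Real.cos B + Real.sin C * Real.cos C| ≤ 2 := by
    linarith [abs_add_le (Real.sin B * Real.cos B) (Real.sin C * Real.cos C),
      abs_sin_mul_cos_le_one B, abs_sin_mul_cos_le_one C]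
  calc _ ≤ 2 / (4 * Real.sin δ₀ * Real.sin δ₀ * Real.sin δ₀) := by gcongr
    _ = _ := by field_simp; norm_num
end

section
/- Let A, B, C ∈ (0, π/2) with A + B + C = π, let R > 0, b = 2R·sin(B), c = 2R·sin(C), and μ = 2R²·sin(A)·sin(B)·sin(C). Then μ/4 ≤ b²/(8·tan(B)) + c²/(8·tan(C)) ≤ μ/2; equivalently, 2·sin(A)·sin(B)·sin(C) ≤ sin(2B) + sin(2C) ≤ 4·sin(A)·sin(B)·sin(C). -/
open Real

theorem sin_two_mul_add_sin_two_mul (x y : ℝ) :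
    sin (2 * x) + sin (2 * y) = 2 * sin (x + y) * (cos x * cos y + sin x * sin y) := by
  rw [sin_two_mul, sin_two_mul, sin_add]
  linear_combination (-2 * sin x * cos x) * sin_sq_add_cos_sq y
    - 2 * sin y * cos y * sin_sq_add_cos_sq x

theorem sq_chord_div_eight_tan (R : ℝ) {x : ℝ} (hs : sin x ≠ 0) (hc : cos x ≠ 0) :
    (2 * R * sin x) ^ 2 / (8 * tan x) = R ^ 2 / 4 * sin (2 * x) := by
  rw [tan_eq_sin_div_cos, sin_two_mul]
  field_simp
  ring

theorem dual_vertex_area_bounds_acute_triangle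
    (A B C R b c μ : ℝ)
    (hA : A ∈ Set.Ioo 0 (π / 2)) (hB : B ∈ Set.Ioo 0 (π / 2)) (hC : C ∈ Set.Ioo 0 (π / 2))
    (hsum : A + B + C = π) (hR : 0 < R)
    (hb : b = 2 * R * Real.sin B) (hc : c = 2 * R * Real.sin C)
    (hμ : μ = 2 * R ^ 2 * Real.sin A * Real.sin B * Real.sin C) :
    (μ / 4 ≤ b ^ 2 / (8 * Real.tan B) + c ^ 2 / (8 * Real.tan C) ∧
      b ^ 2 / (8 * Real.tan B) + c ^ 2 / (8 * Real.tan C) ≤ μ / 2) ∧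
    (2 * Real.sin A * Real.sin B * Real.sin C ≤ Real.sin (2 * B) + Real.sin (2 * C) ∧
      Real.sin (2 * B) + Real.sin (2 * C) ≤ 4 * Real.sin A * Real.sin B * Real.sin C) := by
  obtain ⟨hA0, hA1⟩ := hA
  obtain ⟨hB0, hB1⟩ := hB
  obtain ⟨hC0, hC1⟩ := hC
  have hsA : 0 < sin A := sin_pos_of_pos_of_lt_pi hA0 (by linarith)
  have hsB : 0 < sin B := sin_pos_of_pos_of_lt_pi hB0 (by linarith)
  have hsC : 0 < sin C := sin_pos_of_pos_of_lt_pi hC0 (by linarith)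
  have hcA : 0 < cos A := cos_pos_of_mem_Ioo ⟨by linarith, hA1⟩
  have hcB : 0 < cos B := cos_pos_of_mem_Ioo ⟨by linarith, hB1⟩
  have hcC : 0 < cos C := cos_pos_of_mem_Ioo ⟨by linarith, hC1⟩
  have hcosA : cos A = sin B * sin C - cos B * cos C := by
    rw [show A = π - (B + C) by linarith, cos_pi_sub, cos_add]
    ring
  have hsin : sin (2 * B) + sin (2 * C) = 2 * sin A * (cos B * cos C + sin B * sin C) := by
    rw [show A = π - (B + C) by linarith, sin_pi_sub]
    exact sin_two_mul_add_sin_two_mul B C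
  have hlower : 2 * sin A * sin B * sin C ≤ sin (2 * B) + sin (2 * C) := by
    rw [hsin]
    linarith [mul_pos hsA (mul_pos hcB hcC)]
  have hupper : sin (2 * B) + sin (2 * C) ≤ 4 * sin A * sin B * sin C := by
    have h := mul_pos hsA hcA
    rw [hcosA] at h
    rw [hsin]
    linarith
  have hdual : b ^ 2 / (8 * tan B) + c ^ 2 / (8 * tan C)
      = R ^ 2 / 4 * (sin (2 * B) + sin (2 * C)) := by
    rw [hb, hc, sq_chord_div_eight_tan R hsB.ne' hcB.ne',
      sq_chord_div_eight_tan R hsC.ne' hcC.ne']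
    ring
  have hR2 : 0 ≤ R ^ 2 / 4 := by positivity
  refine ⟨?_, hlower, hupper⟩
  rw [hdual, hμ]
  constructor
  · linarith [mul_le_mul_of_nonneg_left hlower hR2]
  · linarith [mul_le_mul_of_nonneg_left hupper hR2]
end

section
/- Let V and W be finite-dimensional real inner product spaces, let d : V → W be linear, and define the graph norm ‖v‖_V := (‖v‖² + ‖dv‖²)^{1/2}. Let Z = ker d, and assume the Poincaré inequality ‖w‖_V ≤ c_P·‖dw‖ holds for all w in the orthogonal complement of Z in V. Let B be a symmetric bilinear form on V and 0 ≤ ε < 1 with |⟨u, w⟩ − B(u, w)| ≤ ε·‖u‖_V·‖w‖_V for all u, w ∈ V. Then for every v ∈ V with B(v, z) = 0 for all z ∈ Z, one has ‖v‖_V ≤ (c_P/(1 − ε))·‖dv‖. -/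
open scoped RealInnerProductSpace

theorem dec_poincare_inequality_abstract
    {V W : Type*} [NormedAddCommGroup V] [InnerProductSpace ℝ V] [FiniteDimensional ℝ V]
    [NormedAddCommGroup W] [InnerProductSpace ℝ W] [FiniteDimensional ℝ W]
    (d : V →ₗ[ℝ] W) (c_P : ℝ)
    (hPoincare : ∀ w ∈ (LinearMap.ker d)ᗮ,
      Real.sqrt (‖w‖ ^ 2 + ‖d w‖ ^ 2) ≤ c_P * ‖d w‖)
    (B : V →ₗ[ℝ] V →ₗ[ℝ] ℝ) (hBsymm : ∀ u w : V, B u w = B w u)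
    (ε : ℝ) (hε : 0 ≤ ε) (hε1 : ε < 1)
    (hconsistency : ∀ u w : V,
      |⟪u, w⟫ - B u w| ≤ ε * Real.sqrt (‖u‖ ^ 2 + ‖d u‖ ^ 2) * Real.sqrt (‖w‖ ^ 2 + ‖d w‖ ^ 2))
    (v : V) (hv : ∀ z ∈ LinearMap.ker d, B v z = 0) :
    Real.sqrt (‖v‖ ^ 2 + ‖d v‖ ^ 2) ≤ (c_P / (1 - ε)) * ‖d v‖ := by
  obtain ⟨z, hz, w, hw, hvzw⟩ := (LinearMap.ker d).exists_add_mem_mem_orthogonal v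
  have hdz : d z = 0 := hz
  have hdv : d v = d w := by rw [hvzw, map_add, hdz, zero_add]
  have hzw : ⟪z, w⟫ = 0 := hw z hz
  have hnorm : ‖v‖ ^ 2 = ‖z‖ ^ 2 + ‖w‖ ^ 2 := by
    rw [hvzw, norm_add_sq_real, hzw]
    ring
  have hvz : ⟪v, z⟫ = ‖z‖ ^ 2 := by
    rw [hvzw, inner_add_left, real_inner_self_eq_norm_sq, real_inner_comm, hzw, add_zero]
  have hP := hPoincare w hw
  have hC := (le_abs_self _).trans (hconsistency v z)
  rw [hv z hz, hvz, hdz, norm_zero, sub_zero, zero_pow two_ne_zero, add_zero,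
    Real.sqrt_sq (norm_nonneg z)] at hC
  have hz_le : ‖z‖ ≤ ε * √(‖v‖ ^ 2 + ‖d v‖ ^ 2) := by
    rcases (norm_nonneg z).eq_or_lt with h | h
    · rw [← h]
      positivity
    · exact le_of_mul_le_mul_right (by rwa [← sq]) h
  have htri : √(‖v‖ ^ 2 + ‖d v‖ ^ 2) ≤ ‖z‖ + √(‖w‖ ^ 2 + ‖d w‖ ^ 2) := by
    rw [hnorm, hdv, add_assoc]
    refine Real.sqrt_le_iff.mpr ⟨by positivity, ?_⟩
    rw [add_sq, Real.sq_sqrt (by positivity)]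
    have : 0 ≤ 2 * ‖z‖ * √(‖w‖ ^ 2 + ‖d w‖ ^ 2) := by positivity
    linarith
  rw [div_mul_eq_mul_div, le_div_iff₀ (sub_pos.mpr hε1)]
  rw [← hdv] at hP htri
  linarith
end

section
/- Let V be a finite-dimensional real inner product space, let 𝔅 ⊆ Z ⊆ V be subspaces, let B be a symmetric positive-definite bilinear form on V, and let ε ≥ 0 satisfy |⟨u, w⟩ − B(u, w)| ≤ ε·‖u‖·‖w‖ for all u, w ∈ Z. Define the FEEC harmonic space H := { z ∈ Z : ⟨z, b⟩ = 0 for all b ∈ 𝔅 } and the DEC harmonic space Ĥ := { z ∈ Z : B(z, b) = 0 for all b ∈ 𝔅 }. Let Π : Ĥ → H send p̂ to the component of p̂ in H under the orthogonal decomposition Z = H ⊕ 𝔅. Then Π is a linear bijection and ‖Π(p̂) − p̂‖ ≤ ε·‖p̂‖ for all p̂ ∈ Ĥ. -/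
open scoped RealInnerProductSpace

/-- A bilinear form that is definite on a finite-dimensional subspace `S` represents
every functional on `S` by an element of `S`. -/
theorem LinearMap.exists_mem_forall_apply_eq_of_pos
    {V : Type*} [AddCommGroup V] [Module ℝ V] (S : Submodule ℝ V) [FiniteDimensional ℝ S]
    (B : V →ₗ[ℝ] V →ₗ[ℝ] ℝ) (hB : ∀ v ∈ S, v ≠ 0 → 0 < B v v) (f : V →ₗ[ℝ] ℝ) :
    ∃ v ∈ S, ∀ w ∈ S, B v w = f w := by
  have hinj : Function.Injective (B.domRestrict₁₂ S S) := by
    rw [injective_iff_map_eq_zero]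
    intro v hv
    by_contra hne
    have hvv : B v v = 0 := LinearMap.congr_fun hv v
    exact (hB v v.2 (by simpa using hne)).ne' hvv
  have hsurj : Function.Surjective (B.domRestrict₁₂ S S) :=
    (LinearMap.injective_iff_surjective_of_finrank_eq_finrank
      (Subspace.dual_finrank_eq (K := ℝ) (V := S)).symm).mp hinj
  obtain ⟨v, hv⟩ := hsurj (f.domRestrict S)
  exact ⟨v, v.2, fun w hw => LinearMap.congr_fun hv ⟨w, hw⟩⟩

theorem dec_feec_harmonic_forms_comparison
    {V : Type*} [NormedAddCommGroup V] [InnerProductSpace ℝ V] [FiniteDimensional ℝ V]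
    (𝔅 Z : Submodule ℝ V) (h𝔅Z : 𝔅 ≤ Z)
    (B : V →ₗ[ℝ] V →ₗ[ℝ] ℝ) (hBsymm : ∀ u w : V, B u w = B w u)
    (hBpos : ∀ v : V, v ≠ 0 → 0 < B v v)
    (ε : ℝ) (hε : 0 ≤ ε)
    (hconsistency : ∀ u ∈ Z, ∀ w ∈ Z, |⟪u, w⟫ - B u w| ≤ ε * ‖u‖ * ‖w‖)
    (H Hhat : Set V)
    (hH : H = {z | z ∈ Z ∧ ∀ b ∈ 𝔅, ⟪z, b⟫ = 0})
    (hHhat : Hhat = {z | z ∈ Z ∧ ∀ b ∈ 𝔅, B z b = 0})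
    (Pi : V →ₗ[ℝ] V)
    (hPi : ∀ p ∈ Hhat, Pi p ∈ H ∧ p - Pi p ∈ 𝔅) :
    Set.BijOn Pi Hhat H ∧ ∀ p ∈ Hhat, ‖Pi p - p‖ ≤ ε * ‖p‖ := by
  subst hH hHhat
  refine ⟨⟨fun p hp => (hPi p hp).1, ?_, ?_⟩, ?_⟩
  · intro p hp q hq hpq
    have hmem : p - q ∈ 𝔅 := by
      have h := 𝔅.sub_mem (hPi p hp).2 (hPi q hq).2
      rwa [hpq, sub_sub_sub_cancel_right] at h
    by_contra hne
    refine (hBpos (p - q) (sub_ne_zero.mpr hne)).ne' ?_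
    rw [LinearMap.map_sub₂, hp.2 _ hmem, hq.2 _ hmem, sub_zero]
  · intro z hz
    obtain ⟨b, hb, hbz⟩ :=
      LinearMap.exists_mem_forall_apply_eq_of_pos 𝔅 B (fun v _ => hBpos v) (B z : V →ₗ[ℝ] ℝ)
    have hp : z - b ∈ {z | z ∈ Z ∧ ∀ b ∈ 𝔅, B z b = 0} :=
      ⟨Z.sub_mem hz.1 (h𝔅Z hb), fun w hw => by
        rw [LinearMap.map_sub₂, hbz w hw, sub_self]⟩
    obtain ⟨hmemH, hdiff⟩ := hPi _ hp
    have hmem : z - Pi (z - b) ∈ 𝔅 := by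
      have h := 𝔅.add_mem hdiff hb
      rwa [sub_right_comm, sub_add_cancel] at h
    refine ⟨z - b, hp, (sub_eq_zero.mp ?_).symm⟩
    rw [← inner_self_eq_zero (𝕜 := ℝ), inner_sub_left, hz.2 _ hmem, hmemH.2 _ hmem, sub_zero]
  · intro p hp
    obtain ⟨hmemH, hb⟩ := hPi p hp
    have hsq : ‖p - Pi p‖ * ‖p - Pi p‖ ≤ ε * ‖p‖ * ‖p - Pi p‖ := by
      calc ‖p - Pi p‖ * ‖p - Pi p‖ = ⟪p, p - Pi p⟫ - B p (p - Pi p) := by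
            rw [← real_inner_self_eq_norm_mul_norm, inner_sub_left (𝕜 := ℝ) p (Pi p),
              hmemH.2 _ hb, hp.2 _ hb]
        _ ≤ ε * ‖p‖ * ‖p - Pi p‖ :=
            (le_abs_self _).trans (hconsistency p hp.1 _ (h𝔅Z hb))
    rw [norm_sub_rev]
    rcases (norm_nonneg (p - Pi p)).eq_or_lt with h0 | hpos
    · rw [← h0]
      positivity
    · exact le_of_mul_le_mul_right hsq hpos
end

section
/- Let V⁰, V¹, V² be finite-dimensional real inner product spaces and d⁰ : V⁰ → V¹, d¹ : V¹ → V² linear maps with d¹ ∘ d⁰ = 0. Define graph norms ‖τ‖_V := (‖τ‖² + ‖d⁰τ‖²)^{1/2} on V⁰ and ‖v‖_V := (‖v‖² + ‖d¹v‖²)^{1/2} on V¹, and the harmonic space H := ker d¹ ∩ (range d⁰)^⊥ ⊆ V¹. Assume the Poincaré inequalities: ‖ρ‖_V ≤ c_P·‖d⁰ρ‖ for all ρ ∈ (ker d⁰)^⊥, and ‖v‖_V ≤ c_P·‖d¹v‖ for all v ∈ (ker d¹)^⊥ in V¹. Let D⁰, D¹, D² be symmetric positive-definite bilinear forms on V⁰,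 V¹, V² respectively, and let ε ≥ 0 be such that each |Dⁱ(u, w) − ⟨u, w⟩| ≤ ε·‖u‖_V·‖w‖_V (with the norm on V² being the inner product norm). Define B_D(σ, u, p; τ, v, q) := D⁰(σ, τ) − D¹(d⁰τ, u) + D¹(d⁰σ, v) + D²(d¹u, d¹v) + D¹(v, p) − D¹(u, q). Then there exist constants γ > 0 and ε₀ > 0 depending only on c_P such that whenever ε ≤ ε₀, for every (σ, u, p) ∈ V⁰ × V¹ × H there exists (τ, v, q) ∈ V⁰ × V¹ × H with B_D(σ, u, p; τ, v, q) ≥ γ·(‖σ‖_V + ‖u‖_V + ‖p‖)·(‖τ‖_V + ‖v‖_V + ‖q‖). -/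
open scoped RealInnerProductSpace

section

variable {E F G : Type*} [NormedAddCommGroup E] [InnerProductSpace ℝ E]
  [NormedAddCommGroup F] [InnerProductSpace ℝ F] [NormedAddCommGroup G] [InnerProductSpace ℝ G]

/-- The graph norm of a linear map. -/
noncomputable def graphNorm (d : E →ₗ[ℝ] F) (x : E) : ℝ :=
  Real.sqrt (‖x‖ ^ 2 + ‖d x‖ ^ 2)

theorem graphNorm_def (d : E →ₗ[ℝ] F) (x : E) :
    graphNorm d x = Real.sqrt (‖x‖ ^ 2 + ‖d x‖ ^ 2) := rfl

theorem graphNorm_nonneg (d : E →ₗ[ℝ] F) (x : E) : 0 ≤ graphNorm d x :=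
  Real.sqrt_nonneg _

theorem graphNorm_sq (d : E →ₗ[ℝ] F) (x : E) : graphNorm d x ^ 2 = ‖x‖ ^ 2 + ‖d x‖ ^ 2 :=
  Real.sq_sqrt (by positivity)

theorem norm_le_graphNorm (d : E →ₗ[ℝ] F) (x : E) : ‖x‖ ≤ graphNorm d x :=
  Real.le_sqrt_of_sq_le (le_add_of_nonneg_right (sq_nonneg _))

theorem norm_map_le_graphNorm (d : E →ₗ[ℝ] F) (x : E) : ‖d x‖ ≤ graphNorm d x :=
  Real.le_sqrt_of_sq_le (le_add_of_nonneg_left (sq_nonneg _))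

theorem graphNorm_of_map_eq_zero {d : E →ₗ[ℝ] F} {x : E} (hx : d x = 0) :
    graphNorm d x = ‖x‖ := by
  simp [graphNorm, hx]

theorem graphNorm_eq_norm_toLp (d : E →ₗ[ℝ] F) (x : E) :
    graphNorm d x = ‖WithLp.toLp 2 (x, d x)‖ :=
  (WithLp.prod_norm_eq_of_L2 (WithLp.toLp 2 (x, d x))).symm

theorem graphNorm_add_le (d : E →ₗ[ℝ] F) (x y : E) :
    graphNorm d (x + y) ≤ graphNorm d x + graphNorm d y := by
  simp only [graphNorm_eq_norm_toLp, map_add, ← Prod.mk_add_mk, WithLp.toLp_add]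
  exact norm_add_le _ _

theorem graphNorm_smul (d : E →ₗ[ℝ] F) (c : ℝ) (x : E) :
    graphNorm d (c • x) = |c| * graphNorm d x := by
  simp only [graphNorm_eq_norm_toLp, map_smul, ← Prod.smul_mk, WithLp.toLp_smul, norm_smul,
    Real.norm_eq_abs]

theorem graphNorm_sub_le (d : E →ₗ[ℝ] F) (x y : E) :
    graphNorm d (x - y) ≤ graphNorm d x + graphNorm d y := by
  have h := graphNorm_add_le d x ((-1 : ℝ) • y)
  rwa [graphNorm_smul, neg_one_smul, ← sub_eq_add_neg, abs_neg, abs_one, one_mul] at h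

theorem exists_hodge_decomposition [FiniteDimensional ℝ E] [FiniteDimensional ℝ F]
    (d₀ : E →ₗ[ℝ] F) (d₁ : F →ₗ[ℝ] G) (hd : ∀ x, d₁ (d₀ x) = 0) (u : F) :
    ∃ ρ ∈ (LinearMap.ker d₀)ᗮ, ∃ h ∈ LinearMap.ker d₁ ⊓ (LinearMap.range d₀)ᗮ,
      ∃ w ∈ (LinearMap.ker d₁)ᗮ, u = d₀ ρ + h + w := by
  obtain ⟨k, hk, w, hw, rfl⟩ := (LinearMap.ker d₁).exists_add_mem_mem_orthogonal u
  obtain ⟨_, ⟨x, rfl⟩, h, hh, rfl⟩ := (LinearMap.range d₀).exists_add_mem_mem_orthogonal k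
  obtain ⟨z, hz, ρ, hρ, rfl⟩ := (LinearMap.ker d₀).exists_add_mem_mem_orthogonal x
  refine ⟨ρ, hρ, h, ⟨?_, hh⟩, w, hw, ?_⟩
  · simpa [hd] using hk
  · rw [map_add, LinearMap.mem_ker.1 hz, zero_add]

/-- Inf-sup stability of the mixed Hodge-Laplace form for the exact inner products, with control
of the size of the test functions. -/
theorem exists_hodgeLaplace_test [FiniteDimensional ℝ E] [FiniteDimensional ℝ F]
    (d₀ : E →ₗ[ℝ] F) (d₁ : F →ₗ[ℝ] G) (hd : ∀ x, d₁ (d₀ x) = 0) {C : ℝ} (hC : 1 ≤ C)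
    (h₀ : ∀ ρ ∈ (LinearMap.ker d₀)ᗮ, graphNorm d₀ ρ ^ 2 ≤ C * ‖d₀ ρ‖ ^ 2)
    (h₁ : ∀ w ∈ (LinearMap.ker d₁)ᗮ, graphNorm d₁ w ^ 2 ≤ C * ‖d₁ w‖ ^ 2)
    (σ : E) (u p : F) (hp : p ∈ LinearMap.ker d₁ ⊓ (LinearMap.range d₀)ᗮ) :
    ∃ (τ : E) (v q : F), q ∈ LinearMap.ker d₁ ⊓ (LinearMap.range d₀)ᗮ ∧
      graphNorm d₀ τ + graphNorm d₁ v + ‖q‖ ≤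
        3 * (graphNorm d₀ σ + graphNorm d₁ u + ‖p‖) ∧
      (graphNorm d₀ σ + graphNorm d₁ u + ‖p‖) ^ 2 / (6 * C) ≤
        ⟪σ, τ⟫ - ⟪d₀ τ, u⟫ + ⟪d₀ σ, v⟫ + ⟪d₁ u, d₁ v⟫ + ⟪v, p⟫ - ⟪u, q⟫ := by
  obtain ⟨ρ, hρ, h, hh, w, hw, hu⟩ := exists_hodge_decomposition d₀ d₁ hd u
  have hC0 : 0 < C := by linarith
  have hdh : d₁ h = 0 := hh.1
  have hdp : d₁ p = 0 := hp.1
  have ph : ∀ x, ⟪d₀ x, h⟫ = 0 := fun x => hh.2 _ ⟨x, rfl⟩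
  have pp : ∀ x, ⟪d₀ x, p⟫ = 0 := fun x => hp.2 _ ⟨x, rfl⟩
  have pw : ∀ x, ⟪d₀ x, w⟫ = 0 := fun x => hw _ (hd x)
  have hhw : ⟪h, w⟫ = 0 := hw _ hdh
  have hdu : d₁ u = d₁ w := by simp [hu, hd, hdh]
  have hρu : ⟪d₀ ρ, u⟫ = ‖d₀ ρ‖ ^ 2 := by
    simp [hu, inner_add_right, ph, pw]
  have huh : ⟪u, h⟫ = ‖h‖ ^ 2 := by
    simp [hu, inner_add_left, ph, real_inner_comm h w, hhw]
  have hun : ‖u‖ ^ 2 = ‖d₀ ρ‖ ^ 2 + ‖h‖ ^ 2 + ‖w‖ ^ 2 := by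
    rw [hu, norm_add_sq_real, norm_add_sq_real, ph, inner_add_left, pw, hhw]
    ring
  have hρV := h₀ ρ hρ
  have hwV := h₁ w hw
  have hu2 := graphNorm_sq d₁ u
  have hσ2 := graphNorm_sq d₀ σ
  rw [graphNorm_sq] at hwV
  refine ⟨σ - C⁻¹ • ρ, u + d₀ σ + p, p - h, Submodule.sub_mem _ hp hh, ?_, ?_⟩
  · have hτ : graphNorm d₀ (C⁻¹ • ρ) ≤ graphNorm d₁ u := by
      rw [graphNorm_smul, abs_of_pos (inv_pos.2 hC0), inv_mul_le_iff₀ hC0]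
      refine (sq_le_sq₀ (graphNorm_nonneg _ _) (mul_nonneg hC0.le (graphNorm_nonneg _ _))).1 ?_
      have : ‖d₀ ρ‖ ^ 2 ≤ graphNorm d₁ u ^ 2 := by
        rw [hu2, hun]; nlinarith [sq_nonneg ‖h‖, sq_nonneg ‖w‖, sq_nonneg ‖d₁ u‖]
      calc _ ≤ C * ‖d₀ ρ‖ ^ 2 := hρV
        _ ≤ C * graphNorm d₁ u ^ 2 := by gcongr
        _ ≤ (C * graphNorm d₁ u) ^ 2 := by
          rw [mul_pow]; gcongr; nlinarith
    have hh' : ‖h‖ ≤ graphNorm d₁ u := by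
      refine (sq_le_sq₀ (norm_nonneg _) (graphNorm_nonneg _ _)).1 ?_
      rw [hu2, hun]; nlinarith [sq_nonneg ‖d₀ ρ‖, sq_nonneg ‖w‖, sq_nonneg ‖d₁ u‖]
    have e1 := graphNorm_sub_le d₀ σ (C⁻¹ • ρ)
    have e2 := graphNorm_add_le d₁ (u + d₀ σ) p
    have e3 := graphNorm_add_le d₁ u (d₀ σ)
    rw [graphNorm_of_map_eq_zero hdp] at e2
    rw [graphNorm_of_map_eq_zero (hd σ)] at e3
    have e4 := norm_map_le_graphNorm d₀ σ
    have e5 := norm_sub_le p h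
    linarith [graphNorm_nonneg d₀ σ, norm_nonneg p]
  · have key : ⟪σ, σ - C⁻¹ • ρ⟫ - ⟪d₀ (σ - C⁻¹ • ρ), u⟫ + ⟪d₀ σ, u + d₀ σ + p⟫
        + ⟪d₁ u, d₁ (u + d₀ σ + p)⟫ + ⟪u + d₀ σ + p, p⟫ - ⟪u, p - h⟫ =
        ‖σ‖ ^ 2 - C⁻¹ * ⟪σ, ρ⟫ + C⁻¹ * ‖d₀ ρ‖ ^ 2 + ‖d₀ σ‖ ^ 2 + ‖d₁ u‖ ^ 2 + ‖p‖ ^ 2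
          + ‖h‖ ^ 2 := by
      simp only [inner_add_left, inner_add_right, inner_sub_left, inner_sub_right, map_sub,
        map_add, map_smul, inner_smul_left, inner_smul_right, pp, hd, hdp, hρu, huh,
        real_inner_self_eq_norm_sq, inner_zero_right, RCLike.conj_to_real]
      ring
    have hcs : C⁻¹ * ⟪σ, ρ⟫ ≤ ‖σ‖ ^ 2 / 2 + C⁻¹ * ‖d₀ ρ‖ ^ 2 / 2 := by
      have hi := real_inner_le_norm σ ρ
      have hn : ‖ρ‖ ^ 2 ≤ C * ‖d₀ ρ‖ ^ 2 :=
        (pow_le_pow_left₀ (norm_nonneg _) (norm_le_graphNorm d₀ ρ) 2).trans hρV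
      have hn' : C⁻¹ ^ 2 * ‖ρ‖ ^ 2 ≤ C⁻¹ * ‖d₀ ρ‖ ^ 2 := by
        calc _ ≤ C⁻¹ ^ 2 * (C * ‖d₀ ρ‖ ^ 2) := by gcongr
          _ = _ := by field_simp
      have := mul_le_mul_of_nonneg_left hi (inv_pos.2 hC0).le
      nlinarith [sq_nonneg (‖σ‖ - C⁻¹ * ‖ρ‖)]
    have hS : (graphNorm d₀ σ + graphNorm d₁ u + ‖p‖) ^ 2 ≤
        3 * (graphNorm d₀ σ ^ 2 + graphNorm d₁ u ^ 2 + ‖p‖ ^ 2) := by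
      nlinarith [sq_nonneg (graphNorm d₀ σ - graphNorm d₁ u), sq_nonneg (graphNorm d₀ σ - ‖p‖),
        sq_nonneg (graphNorm d₁ u - ‖p‖)]
    rw [key, div_le_iff₀ (by positivity)]
    refine hS.trans ?_
    rw [hσ2, hu2, hun, hdu]
    have hlow : ‖σ‖ ^ 2 / 2 + C⁻¹ * ‖d₀ ρ‖ ^ 2 / 2 + ‖d₀ σ‖ ^ 2 + ‖d₁ w‖ ^ 2 + ‖p‖ ^ 2 + ‖h‖ ^ 2 ≤
        ‖σ‖ ^ 2 - C⁻¹ * ⟪σ, ρ⟫ + C⁻¹ * ‖d₀ ρ‖ ^ 2 + ‖d₀ σ‖ ^ 2 + ‖d₁ w‖ ^ 2 + ‖p‖ ^ 2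
          + ‖h‖ ^ 2 := by linarith
    refine le_trans ?_ (mul_le_mul_of_nonneg_right hlow (by positivity))
    have hCC : C⁻¹ * ‖d₀ ρ‖ ^ 2 * C = ‖d₀ ρ‖ ^ 2 := by field_simp
    have m (x : ℝ) : x ^ 2 ≤ x ^ 2 * C := le_mul_of_one_le_right (sq_nonneg x) hC
    linarith [m ‖σ‖, m ‖d₀ σ‖, m ‖d₁ w‖, m ‖p‖, m ‖h‖, sq_nonneg ‖d₁ w‖, sq_nonneg ‖d₀ σ‖,
      sq_nonneg ‖p‖, sq_nonneg ‖h‖]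

end

/-- The DEC discrete inf-sup (stability) theorem for the mixed Hodge-Laplace
formulation, in abstract form: the stability constant `γ` and the consistency
threshold `ε₀` depend only on the Poincaré constant `c_P`. -/
theorem dec_inf_sup_abstract (c_P : ℝ) (hc_P : 0 < c_P) :
    ∃ γ > (0 : ℝ), ∃ ε₀ > (0 : ℝ),
      ∀ (V0 V1 V2 : Type)
        [inst0 : NormedAddCommGroup V0] [inst0' : InnerProductSpace ℝ V0]
        [inst0'' : FiniteDimensional ℝ V0]
        [inst1 : NormedAddCommGroup V1] [inst1' : InnerProductSpace ℝ V1]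
        [inst1'' : FiniteDimensional ℝ V1]
        [inst2 : NormedAddCommGroup V2] [inst2' : InnerProductSpace ℝ V2]
        [inst2'' : FiniteDimensional ℝ V2]
        (d0 : V0 →ₗ[ℝ] V1) (d1 : V1 →ₗ[ℝ] V2),
        (∀ τ : V0, d1 (d0 τ) = 0) →
        -- Poincaré inequalities with constant c_P
        (∀ ρ ∈ (LinearMap.ker d0)ᗮ,
          Real.sqrt (‖ρ‖ ^ 2 + ‖d0 ρ‖ ^ 2) ≤ c_P * ‖d0 ρ‖) →
        (∀ v ∈ (LinearMap.ker d1)ᗮ,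
          Real.sqrt (‖v‖ ^ 2 + ‖d1 v‖ ^ 2) ≤ c_P * ‖d1 v‖) →
        ∀ (D0 : V0 →ₗ[ℝ] V0 →ₗ[ℝ] ℝ) (D1 : V1 →ₗ[ℝ] V1 →ₗ[ℝ] ℝ)
          (D2 : V2 →ₗ[ℝ] V2 →ₗ[ℝ] ℝ),
        (∀ u w : V0, D0 u w = D0 w u) → (∀ u : V0, u ≠ 0 → 0 < D0 u u) →
        (∀ u w : V1, D1 u w = D1 w u) → (∀ u : V1, u ≠ 0 → 0 < D1 u u) →
        (∀ u w : V2, D2 u w = D2 w u) → (∀ u : V2, u ≠ 0 → 0 < D2 u u) →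
        ∀ ε : ℝ, 0 ≤ ε →
        -- consistency of the bilinear forms with the inner products
        (∀ u w : V0, |D0 u w - ⟪u, w⟫| ≤
          ε * Real.sqrt (‖u‖ ^ 2 + ‖d0 u‖ ^ 2) * Real.sqrt (‖w‖ ^ 2 + ‖d0 w‖ ^ 2)) →
        (∀ u w : V1, |D1 u w - ⟪u, w⟫| ≤
          ε * Real.sqrt (‖u‖ ^ 2 + ‖d1 u‖ ^ 2) * Real.sqrt (‖w‖ ^ 2 + ‖d1 w‖ ^ 2)) →
        (∀ u w : V2, |D2 u w - ⟪u, w⟫| ≤ ε * ‖u‖ * ‖w‖) →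
        ε ≤ ε₀ →
        ∀ (σ : V0) (u : V1) (p : V1),
          p ∈ LinearMap.ker d1 ⊓ (LinearMap.range d0)ᗮ →
          ∃ (τ : V0) (v : V1) (q : V1),
            q ∈ LinearMap.ker d1 ⊓ (LinearMap.range d0)ᗮ ∧
            D0 σ τ - D1 (d0 τ) u + D1 (d0 σ) v + D2 (d1 u) (d1 v) + D1 v p - D1 u q ≥
              γ * (Real.sqrt (‖σ‖ ^ 2 + ‖d0 σ‖ ^ 2) + Real.sqrt (‖u‖ ^ 2 + ‖d1 u‖ ^ 2) + ‖p‖)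
                * (Real.sqrt (‖τ‖ ^ 2 + ‖d0 τ‖ ^ 2) + Real.sqrt (‖v‖ ^ 2 + ‖d1 v‖ ^ 2) + ‖q‖) := by
  have hC : 0 < c_P ^ 2 + 1 := by positivity
  refine ⟨1 / (36 * (c_P ^ 2 + 1)), by positivity, 1 / (36 * (c_P ^ 2 + 1)), by positivity, ?_⟩
  intro V0 V1 V2 _ _ _ _ _ _ _ _ _ d0 d1 hd h₀ h₁ D0 D1 D2 _ _ _ _ _ _ ε hε c₀ c₁ c₂ hεle σ u p hp
  simp only [← graphNorm_def] at h₀ h₁ c₀ c₁ ⊢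
  obtain ⟨τ, v, q, hq, hY, hB⟩ := exists_hodgeLaplace_test d0 d1 hd (C := c_P ^ 2 + 1)
    (by nlinarith)
    (fun ρ hρ => by
      nlinarith [pow_le_pow_left₀ (graphNorm_nonneg d0 ρ) (h₀ ρ hρ) 2, sq_nonneg ‖d0 ρ‖])
    (fun w hw => by
      nlinarith [pow_le_pow_left₀ (graphNorm_nonneg d1 w) (h₁ w hw) 2, sq_nonneg ‖d1 w‖])
    σ u p hp
  refine ⟨τ, v, q, hq, ?_⟩
  have hpn := graphNorm_of_map_eq_zero (d := d1) hp.1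
  have hqn := graphNorm_of_map_eq_zero (d := d1) hq.1
  have b₁ := (abs_le.1 (c₀ σ τ)).1
  have b₂ := (abs_le.1 (c₁ (d0 τ) u)).2
  have b₃ := (abs_le.1 (c₁ (d0 σ) v)).1
  have b₄ := (abs_le.1 (c₂ (d1 u) (d1 v))).1
  have b₅ := (abs_le.1 (c₁ v p)).1
  have b₆ := (abs_le.1 (c₁ u q)).2
  rw [graphNorm_of_map_eq_zero (hd τ)] at b₂
  rw [graphNorm_of_map_eq_zero (hd σ)] at b₃
  rw [hpn] at b₅
  rw [hqn] at b₆
  have nσ := graphNorm_nonneg d0 σ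
  have nτ := graphNorm_nonneg d0 τ
  have nu := graphNorm_nonneg d1 u
  have nv := graphNorm_nonneg d1 v
  have g₂ : ε * ‖d0 τ‖ * graphNorm d1 u ≤ ε * graphNorm d0 τ * graphNorm d1 u := by
    gcongr; exact norm_map_le_graphNorm d0 τ
  have g₃ : ε * ‖d0 σ‖ * graphNorm d1 v ≤ ε * graphNorm d0 σ * graphNorm d1 v := by
    gcongr; exact norm_map_le_graphNorm d0 σ
  have g₄ : ε * ‖d1 u‖ * ‖d1 v‖ ≤ ε * graphNorm d1 u * graphNorm d1 v := by
    gcongr <;> exact norm_map_le_graphNorm d1 _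
  set a := graphNorm d0 σ
  set b := graphNorm d1 u
  set a' := graphNorm d0 τ
  set b' := graphNorm d1 v
  have herr : ε * a * a' + ε * a' * b + ε * a * b' + ε * b * b' + ε * b' * ‖p‖ + ε * b * ‖q‖ ≤
      ε * ((a + b + ‖p‖) * (a' + b' + ‖q‖)) := by
    have : 0 ≤ ε * (a * ‖q‖ + ‖p‖ * a' + ‖p‖ * ‖q‖) := by positivity
    linarith
  have hXY : (a + b + ‖p‖) * (a' + b' + ‖q‖) ≤ 3 * (a + b + ‖p‖) ^ 2 := by
    calc _ ≤ (a + b + ‖p‖) * (3 * (a + b + ‖p‖)) := by gcongr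
      _ = _ := by ring
  have hεXY : ε * ((a + b + ‖p‖) * (a' + b' + ‖q‖)) ≤
      1 / (36 * (c_P ^ 2 + 1)) * ((a + b + ‖p‖) * (a' + b' + ‖q‖)) := by gcongr
  have hmain : 2 * (1 / (36 * (c_P ^ 2 + 1)) * ((a + b + ‖p‖) * (a' + b' + ‖q‖))) ≤
      (a + b + ‖p‖) ^ 2 / (6 * (c_P ^ 2 + 1)) := by
    calc _ ≤ 2 * (1 / (36 * (c_P ^ 2 + 1)) * (3 * (a + b + ‖p‖) ^ 2)) := by gcongr
      _ = _ := by field_simp; ring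
  linarith
end

section
/- Let δ₀ > 0 and let A, B, C ∈ [δ₀, π) with A + B + C = π. Then sin(A)·sin(B)·sin(C)/(sin(A) + sin(B) + sin(C)) ≥ sin³(δ₀)/3. -/
open Real

theorem shape_constant_lower_bound_of_angle_bound
    (δ₀ A B C : ℝ) (hδ₀ : 0 < δ₀)
    (hA : A ∈ Set.Ico δ₀ π) (hB : B ∈ Set.Ico δ₀ π) (hC : C ∈ Set.Ico δ₀ π)
    (hsum : A + B + C = π) :
    Real.sin A * Real.sin B * Real.sin C / (Real.sin A + Real.sin B + Real.sin C)
      ≥ (Real.sin δ₀) ^ 3 / 3 := by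
  obtain ⟨hA, -⟩ := hA
  obtain ⟨hB, -⟩ := hB
  obtain ⟨hC, -⟩ := hC
  have hs : 0 < Real.sin δ₀ := Real.sin_pos_of_pos_of_lt_pi hδ₀ (by linarith)
  have hsA : Real.sin δ₀ ≤ Real.sin A :=
    sin_le_sin_of_le_of_le_pi_sub hδ₀.le hA (by linarith)
  have hsB : Real.sin δ₀ ≤ Real.sin B :=
    sin_le_sin_of_le_of_le_pi_sub hδ₀.le hB (by linarith)
  have hsC : Real.sin δ₀ ≤ Real.sin C :=
    sin_le_sin_of_le_of_le_pi_sub hδ₀.le hC (by linarith)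
  have hpA : 0 < Real.sin A := hs.trans_le hsA
  have hpB : 0 < Real.sin B := hs.trans_le hsB
  have hpC : 0 < Real.sin C := hs.trans_le hsC
  have hprod : Real.sin δ₀ ^ 3 ≤ Real.sin A * Real.sin B * Real.sin C := by
    calc Real.sin δ₀ ^ 3 = Real.sin δ₀ * Real.sin δ₀ * Real.sin δ₀ := by ring
      _ ≤ Real.sin A * Real.sin B * Real.sin C := by gcongr
  exact div_le_div₀ (by positivity) hprod (by positivity)
    (by linarith [Real.sin_le_one A, Real.sin_le_one B, Real.sin_le_one C])
end

section
/- Let A, B, C be real numbers with 0 < A ≤ B ≤ C and A + B + C = π, and suppose sin(A)·sin(B)·sin(C)/(sin(A) + sin(B) + sin(C)) ≥ ε for some ε > 0. Then sin(A) ≥ 3ε². -/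
open Real

theorem smallest_angle_lower_bound_of_shape_constant
    (A B C ε : ℝ) (hA : 0 < A) (hAB : A ≤ B) (hBC : B ≤ C)
    (hsum : A + B + C = π) (hε : 0 < ε)
    (h : Real.sin A * Real.sin B * Real.sin C / (Real.sin A + Real.sin B + Real.sin C) ≥ ε) :
    Real.sin A ≥ 3 * ε ^ 2 := by
  have ha : 0 < sin A := sin_pos_of_pos_of_lt_pi hA (by linarith)
  have hb : 0 < sin B := sin_pos_of_pos_of_lt_pi (by linarith) (by linarith)
  have hc : 0 < sin C := sin_pos_of_pos_of_lt_pi (by linarith) (by linarith)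
  have hbc : 0 < sin B * sin C := mul_pos hb hc
  rw [ge_iff_le, le_div_iff₀ (by positivity)] at h
  have hsum_ge : 2 * (sin B * sin C) ≤ sin A + sin B + sin C := by
    have h₁ := mul_le_of_le_one_right hb.le (sin_le_one C)
    have h₂ := mul_le_of_le_one_left hc.le (sin_le_one B)
    linarith
  have hle : 2 * ε ≤ sin A := by
    refine le_of_mul_le_mul_right ?_ hbc
    linarith [mul_le_mul_of_nonneg_left hsum_ge hε.le]
  nlinarith [sin_le_one A]
end
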